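/- Let J be a prime ideal of ℬ[x] with x ∉ J such that 𝔄_J = {a ≥ 1 : 1+x^a ∈ J} is finite. If the ideal generated by {1+x^a+x^m : a ∈ 𝔄_J, m ≥ 0} is contained in J, then J equals the ideal generated by {1+x^a+x^m : a ∈ 𝔄_J, m ≥ 0}. -/

import Mathlib

/-- The Boolean semifield `𝔹 = {0, 1}` with `1 + 1 = 1`
    (addition is `∨`, multiplication is `∧`). -/
def BoolSemiring : Type := Bool

namespace BoolSemiring

instance : Zero BoolSemiring := ⟨(false : Bool)⟩
instance : One BoolSemiring := ⟨(true : Bool)⟩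
instance : Add BoolSemiring := ⟨fun a b => ((a : Bool) || (b : Bool) : Bool)⟩
instance : Mul BoolSemiring := ⟨fun a b => ((a : Bool) && (b : Bool) : Bool)⟩
instance : DecidableEq BoolSemiring := fun a b => instDecidableEqBool a b
instance : Fintype BoolSemiring := Bool.fintype

instance : CommSemiring BoolSemiring where
  add_assoc := by decide
  zero_add := by decide
  add_zero := by decide
  add_comm := by decide
  mul_assoc := by decide
  one_mul := by decide
  mul_one := by decide
  zero_mul := by decide
  mul_zero := by decide
  left_distrib := by decide
  right_distrib := by decide
  mul_comm := by decide
  nsmul := nsmulRec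

end BoolSemiring

notation "𝔹" => BoolSemiring

open Polynomial

/-- The set `𝔄_J = {a ≥ 1 : 1 + x^a ∈ J}` associated to an ideal `J` of `𝔹[x]`. -/
def AJ (J : Ideal (Polynomial 𝔹)) : Set ℕ :=
  {a : ℕ | 1 ≤ a ∧ (1 : Polynomial 𝔹) + X ^ a ∈ J}

namespace BoolSemiring

theorem add_ne_zero_iff : ∀ a b : 𝔹, a + b ≠ 0 ↔ a ≠ 0 ∨ b ≠ 0 := by decide

theorem eq_of_ne_zero_iff : ∀ {a b : 𝔹}, (a ≠ 0 ↔ b ≠ 0) → a = b := by decide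

theorem one_ne_zero' : (1 : 𝔹) ≠ 0 := by decide

theorem add_self : ∀ a : 𝔹, a + a = a := by decide

theorem natCast_ne_zero_iff (n : ℕ) : (n : 𝔹) ≠ 0 ↔ n ≠ 0 := by
  cases n with
  | zero => simp
  | succ n => simp [add_ne_zero_iff, one_ne_zero']

theorem coeff_X_pow_ne_zero_iff (n k : ℕ) : (X ^ n : 𝔹[X]).coeff k ≠ 0 ↔ k = n := by
  rw [coeff_X_pow]
  split_ifs with h <;> simp [h, one_ne_zero']

theorem coeff_one_ne_zero_iff (k : ℕ) : (1 : 𝔹[X]).coeff k ≠ 0 ↔ k = 0 := by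
  simpa using coeff_X_pow_ne_zero_iff 0 k

theorem coeff_trinomial_ne_zero_iff (a m k : ℕ) :
    (1 + X ^ a + X ^ m : 𝔹[X]).coeff k ≠ 0 ↔ (k = 0 ∨ k = a) ∨ k = m := by
  rw [coeff_add, coeff_add, add_ne_zero_iff, add_ne_zero_iff, coeff_one_ne_zero_iff,
    coeff_X_pow_ne_zero_iff, coeff_X_pow_ne_zero_iff]

theorem coeff_X_pow_mul_ne_zero_iff (p : 𝔹[X]) (n k : ℕ) :
    (X ^ n * p).coeff k ≠ 0 ↔ n ≤ k ∧ p.coeff (k - n) ≠ 0 := by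
  rw [coeff_X_pow_mul']
  split_ifs with h <;> simp [h]

theorem coeff_one_add_X_pow_mul_ne_zero_iff (p : 𝔹[X]) (n k : ℕ) :
    ((1 + X ^ n) * p).coeff k ≠ 0 ↔ p.coeff k ≠ 0 ∨ n ≤ k ∧ p.coeff (k - n) ≠ 0 := by
  rw [add_mul, one_mul, coeff_add, add_ne_zero_iff, coeff_X_pow_mul_ne_zero_iff]

/-- A Boolean polynomial lies in an ideal as soon as its support is covered by supports, contained
in its own, of members of the ideal. -/
theorem mem_ideal_of_cover (I : Ideal 𝔹[X]) (g : 𝔹[X])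
    (h : ∀ k, g.coeff k ≠ 0 → ∃ p ∈ I, p.coeff k ≠ 0 ∧ ∀ i, p.coeff i ≠ 0 → g.coeff i ≠ 0) :
    g ∈ I := by
  have key : ∀ s : Finset ℕ, s ⊆ g.support →
      ∃ p ∈ I, (∀ k ∈ s, p.coeff k ≠ 0) ∧ ∀ i, p.coeff i ≠ 0 → g.coeff i ≠ 0 := by
    intro s
    induction s using Finset.induction_on with
    | empty => exact fun _ => ⟨0, I.zero_mem, by simp, by simp⟩
    | insert a s _ ih =>
      intro hs
      rw [Finset.insert_subset_iff, mem_support_iff] at hs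
      obtain ⟨p, hp, hps, hpg⟩ := ih hs.2
      obtain ⟨q, hq, hqa, hqg⟩ := h a hs.1
      refine ⟨p + q, I.add_mem hp hq, fun k hk => ?_, fun i hi => ?_⟩
      · rw [coeff_add, add_ne_zero_iff]
        rcases Finset.mem_insert.1 hk with rfl | hk
        · exact Or.inr hqa
        · exact Or.inl (hps k hk)
      · rw [coeff_add, add_ne_zero_iff] at hi
        exact hi.elim (hpg i) (hqg i)
  obtain ⟨p, hp, hpg, hgp⟩ := key g.support subset_rfl
  have : g = p := Polynomial.ext fun k =>
    eq_of_ne_zero_iff ⟨fun hk => hpg k (mem_support_iff.2 hk), hgp k⟩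
  rwa [this]

theorem coeff_zero_prod_one_add_X_pow_ne_zero (s : Finset ℕ) :
    (∏ b ∈ s, (1 + X ^ b : 𝔹[X])).coeff 0 ≠ 0 := by
  induction s using Finset.induction_on with
  | empty => simp [one_ne_zero']
  | insert a s ha ih =>
    rw [Finset.prod_insert ha, coeff_one_add_X_pow_mul_ne_zero_iff]
    exact Or.inl ih

theorem coeff_prod_one_add_X_pow_ne_zero {s : Finset ℕ} {k : ℕ} (hk : k ∈ s) :
    (∏ b ∈ s, (1 + X ^ b : 𝔹[X])).coeff k ≠ 0 := by
  rw [← Finset.mul_prod_erase s _ hk, coeff_one_add_X_pow_mul_ne_zero_iff, Nat.sub_self]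
  exact Or.inr ⟨le_rfl, coeff_zero_prod_one_add_X_pow_ne_zero _⟩

theorem mem_of_coeff_prod_one_add_X_pow_ne_zero (B : AddSubmonoid ℕ) (s : Finset ℕ)
    (hs : ∀ b ∈ s, b ∈ B) (k : ℕ) (hk : (∏ b ∈ s, (1 + X ^ b : 𝔹[X])).coeff k ≠ 0) :
    k ∈ B := by
  induction s using Finset.induction_on generalizing k with
  | empty =>
    rw [Finset.prod_empty, coeff_one_ne_zero_iff] at hk
    exact hk ▸ B.zero_mem
  | insert a s ha ih =>
    have ih := ih fun b hb => hs b (Finset.mem_insert_of_mem hb)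
    rw [Finset.prod_insert ha, coeff_one_add_X_pow_mul_ne_zero_iff] at hk
    rcases hk with hk | ⟨hak, hk⟩
    · exact ih k hk
    · rw [← Nat.add_sub_cancel' hak]
      exact B.add_mem (hs a (Finset.mem_insert_self a s)) (ih _ hk)

end BoolSemiring

open BoolSemiring

/-- The complement of `𝔄_J`, which is closed under addition when `J` contains `1 + x^a + x^m` for all
`a ∈ 𝔄_J` and all `m`. -/
def complAJ (J : Ideal 𝔹[X]) (hJ : J.IsPrime)
    (h : ∀ a ∈ AJ J, ∀ m : ℕ, (1 + X ^ a + X ^ m : 𝔹[X]) ∈ J) : AddSubmonoid ℕ where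
  carrier := {b | b ∉ AJ J}
  zero_mem' h0 := absurd h0.1 (by simp)
  add_mem' := by
    intro b c hb hc hbc
    rcases Nat.eq_zero_or_pos b with rfl | hb0
    · exact hc (by simpa using hbc)
    rcases Nat.eq_zero_or_pos c with rfl | hc0
    · exact hb (by simpa using hbc)
    have hidem : ∀ p : 𝔹[X], p + p = p := fun p => Polynomial.ext fun k => by
      rw [coeff_add, add_self]
    have hmul : ((1 + X ^ b) * (1 + X ^ c) : 𝔹[X]) ∈ J := by
      have : ((1 + X ^ b) * (1 + X ^ c) : 𝔹[X]) =
          (1 + X ^ (b + c) + X ^ b) + (1 + X ^ (b + c) + X ^ c) := by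
        calc ((1 + X ^ b) * (1 + X ^ c) : 𝔹[X])
            = (1 + X ^ (b + c)) + (X ^ b + X ^ c) := by ring
          _ = ((1 + X ^ (b + c)) + (1 + X ^ (b + c))) + (X ^ b + X ^ c) := by rw [hidem]
          _ = _ := by abel
      rw [this]
      exact J.add_mem (h _ hbc b) (h _ hbc c)
    rcases hJ.mem_or_mem hmul with h1 | h1
    · exact hb ⟨hb0, h1⟩
    · exact hc ⟨hc0, h1⟩

theorem exists_mem_AJ_of_coeff_zero_ne_zero (J : Ideal 𝔹[X]) (hJ : J.IsPrime)
    (hfin : (AJ J).Finite)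
    (h : ∀ a ∈ AJ J, ∀ m : ℕ, (1 + X ^ a + X ^ m : 𝔹[X]) ∈ J)
    (f : 𝔹[X]) (hf : f ∈ J) (hf0 : f.coeff 0 ≠ 0) : ∃ a ∈ AJ J, f.coeff a ≠ 0 := by
  by_contra! hbad
  have hdeg : ∀ i, f.coeff i ≠ 0 → i ≤ f.natDegree := fun i => le_natDegree_of_ne_zero
  rcases (AJ J).eq_empty_or_nonempty with hA | ⟨a, ha⟩
  · have hmem : ((1 + X) ^ (2 * f.natDegree) : 𝔹[X]) ∈ J := by
      have hcoeff : ∀ k, ((1 + X) ^ (2 * f.natDegree) : 𝔹[X]).coeff k ≠ 0 ↔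
          k ≤ 2 * f.natDegree := fun k => by
        rw [coeff_one_add_X_pow, natCast_ne_zero_iff, Ne, Nat.choose_eq_zero_iff, not_lt]
      have hlead : f.coeff f.natDegree ≠ 0 := fun h0 => hf0 (by
        rw [leadingCoeff_eq_zero.1 h0, coeff_zero])
      refine mem_ideal_of_cover _ _ fun k hk => ?_
      simp only [hcoeff] at hk ⊢
      rcases le_total k f.natDegree with hkd | hkd
      · refine ⟨X ^ k * f, J.mul_mem_left _ hf, ?_, fun i hi => ?_⟩
        · simpa [coeff_X_pow_mul_ne_zero_iff] using hf0
        · rw [coeff_X_pow_mul_ne_zero_iff] at hi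
          have := hdeg _ hi.2
          omega
      · refine ⟨X ^ (k - f.natDegree) * f, J.mul_mem_left _ hf, ?_, fun i hi => ?_⟩
        · rw [coeff_X_pow_mul_ne_zero_iff, Nat.sub_sub_self hkd]
          exact ⟨Nat.sub_le _ _, hlead⟩
        · rw [coeff_X_pow_mul_ne_zero_iff] at hi
          have := hdeg _ hi.2
          omega
    have h1 : (1 + X ^ 1 : 𝔹[X]) ∈ J := by simpa using hJ.mem_of_pow_mem _ hmem
    exact Set.notMem_empty 1 (hA ▸ (⟨le_rfl, h1⟩ : 1 ∈ AJ J))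
  · classical
    obtain ⟨M, hM⟩ := hfin.bddAbove
    set B := complAJ J hJ h
    have hlarge : ∀ b, M < b → b ∈ B := fun b hb hbA => absurd (hM hbA) (not_le.2 hb)
    have haM : a ≤ M := hM ha
    set D := 2 * M + 2 + f.natDegree
    set s := (Finset.Icc 1 D).filter (· ∈ B) with hs
    have hQ : ∀ k ∈ B, k ≤ D → (∏ b ∈ s, (1 + X ^ b : 𝔹[X])).coeff k ≠ 0 := by
      intro k hk hkD
      rcases Nat.eq_zero_or_pos k with rfl | hk0
      · exact coeff_zero_prod_one_add_X_pow_ne_zero s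
      · exact coeff_prod_one_add_X_pow_ne_zero (by simp [hs, hk, hkD]; omega)
    have hQB := mem_of_coeff_prod_one_add_X_pow_ne_zero B s fun b hb => (Finset.mem_filter.1 hb).2
    have hmem : (∏ b ∈ s, (1 + X ^ b : 𝔹[X])) ∈ J := by
      refine mem_ideal_of_cover _ _ fun k hk => ?_
      rcases le_or_gt (k + f.natDegree) D with hkD | hkD
      · refine ⟨X ^ k * f, J.mul_mem_left _ hf, ?_, fun i hi => ?_⟩
        · simpa [coeff_X_pow_mul_ne_zero_iff] using hf0
        · rw [coeff_X_pow_mul_ne_zero_iff] at hi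
          have hid := hdeg _ hi.2
          refine hQ i ?_ (by omega)
          rw [← Nat.add_sub_cancel' hi.1]
          exact B.add_mem (hQB k hk) fun hA => hi.2 (hbad _ hA)
      · refine ⟨X ^ (M + 1) * (1 + X ^ a + X ^ (k - (M + 1))),
          J.mul_mem_left _ (h a ha _), ?_, fun i hi => ?_⟩
        · rw [coeff_X_pow_mul_ne_zero_iff, coeff_trinomial_ne_zero_iff]
          exact ⟨by omega, Or.inr rfl⟩
        · rw [coeff_X_pow_mul_ne_zero_iff, coeff_trinomial_ne_zero_iff] at hi
          by_cases hik : i = k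
          · exact hik ▸ hk
          · exact hQ i (hlarge i (by omega)) (by omega)
    obtain ⟨b, hb, hbJ⟩ := hJ.prod_mem_iff.1 hmem
    obtain ⟨hb1, hb2⟩ := Finset.mem_filter.1 hb
    exact hb2 ⟨(Finset.mem_Icc.1 hb1).1, hbJ⟩

theorem stmt_12 (J : Ideal (Polynomial 𝔹)) (hJ : J.IsPrime)
    (hx : (X : Polynomial 𝔹) ∉ J)
    (hfin : (AJ J).Finite)
    (h : Ideal.span {f : Polynomial 𝔹 | ∃ a ∈ AJ J, ∃ m : ℕ, f = 1 + X ^ a + X ^ m} ≤ J) :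
    J = Ideal.span {f : Polynomial 𝔹 | ∃ a ∈ AJ J, ∃ m : ℕ, f = 1 + X ^ a + X ^ m} := by
  refine le_antisymm (fun f hf => ?_) h
  have hgen : ∀ a ∈ AJ J, ∀ m : ℕ, (1 + X ^ a + X ^ m : 𝔹[X]) ∈ J := fun a ha m =>
    h (Ideal.subset_span ⟨a, ha, m, rfl⟩)
  by_cases hf0 : f = 0
  · exact hf0 ▸ Ideal.zero_mem _
  obtain ⟨g, hg⟩ : X ^ f.natTrailingDegree ∣ f :=
    X_pow_dvd_iff.2 fun d hd => coeff_eq_zero_of_lt_natTrailingDegree hd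
  have hg0 : g.coeff 0 ≠ 0 := by
    have h1 : f.coeff f.natTrailingDegree ≠ 0 := trailingCoeff_nonzero_iff_nonzero.2 hf0
    have h2 : (X ^ f.natTrailingDegree * g).coeff f.natTrailingDegree ≠ 0 := hg ▸ h1
    simpa [coeff_X_pow_mul_ne_zero_iff] using h2
  have hgJ : g ∈ J :=
    (hJ.mem_or_mem (hg ▸ hf : X ^ f.natTrailingDegree * g ∈ J)).resolve_left
      fun hX => hx (hJ.mem_of_pow_mem _ hX)
  obtain ⟨a, ha, hga⟩ := exists_mem_AJ_of_coeff_zero_ne_zero J hJ hfin hgen g hgJ hg0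
  rw [hg]
  refine Ideal.mul_mem_left _ _ (mem_ideal_of_cover _ _ fun k hk =>
    ⟨1 + X ^ a + X ^ k, Ideal.subset_span ⟨a, ha, k, rfl⟩, ?_, fun i hi => ?_⟩)
  · exact (coeff_trinomial_ne_zero_iff a k k).2 (Or.inr rfl)
  · rcases (coeff_trinomial_ne_zero_iff a k i).1 hi with (rfl | rfl) | rfl <;> assumption
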